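/- arXiv:2605.30253 — 3 statements merged into one kernel-verified Lean document; each statement's English description precedes it below -/
import Mathlib

section
/- Unimodality of the balanced Gaussian mixture posterior in the subcritical regime. Let y₁,…,y_n ∈ ℝ^d, τ > 0, τ₀ > 0, and define the log-posterior (up to an additive constant) g : ℝ^d → ℝ by g(β) := −((nτ + τ₀)/2)·‖β‖² + Σ_{i=1}^n log cosh(τ·⟨y_i, β⟩). If τ²·λ_max(Σ_{i=1}^n y_i y_iᵀ) < nτ + τ₀, then g(β) < g(0) for all β ≠ 0; in particular, β = 0 is the unique global maximizer of g and the posterior is unimodal. -/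
open RealInnerProductSpace

/-- `λ_max`: for a real symmetric matrix, the largest element of its (real) spectrum. -/
noncomputable def lamMax {d : ℕ} (A : Matrix (Fin d) (Fin d) ℝ) : ℝ :=
  sSup (spectrum ℝ A)

open Matrix in
/-- The Rayleigh quotient bound for a real symmetric matrix. -/
theorem dotProduct_mulVec_le_lamMax {d : ℕ} {A : Matrix (Fin d) (Fin d) ℝ}
    (hA : A.IsHermitian) (v : Fin d → ℝ) :
    v ⬝ᵥ A *ᵥ v ≤ lamMax A * (v ⬝ᵥ v) := by
  have hpsd : (algebraMap ℝ (Matrix (Fin d) (Fin d) ℝ) (lamMax A) - A).PosSemidef := by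
    rw [Matrix.posSemidef_iff_isHermitian_and_spectrum_nonneg]
    refine ⟨?_, ?_⟩
    · refine IsHermitian.sub ?_ hA
      rw [Algebra.algebraMap_eq_smul_one]
      simp [IsHermitian]
    · rw [← spectrum.singleton_sub_eq]
      rintro _ ⟨_, rfl, x, hx, rfl⟩
      exact sub_nonneg.2 (le_csSup A.finite_real_spectrum.bddAbove hx)
  have h := hpsd.dotProduct_mulVec_nonneg v
  rw [Algebra.algebraMap_eq_smul_one] at h
  simp only [star_trivial, sub_mulVec, smul_mulVec, one_mulVec, dotProduct_sub,
    dotProduct_smul, smul_eq_mul] at h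
  linarith

open Matrix in
theorem sum_inner_sq_eq_dotProduct_mulVec {d n : ℕ} (y : Fin n → EuclideanSpace ℝ (Fin d))
    (v : EuclideanSpace ℝ (Fin d)) :
    ∑ i, ⟪y i, v⟫ ^ 2
      = v.ofLp ⬝ᵥ (∑ i, Matrix.of fun a b => y i a * y i b) *ᵥ v.ofLp := by
  have hvec (i : Fin n) :
      (Matrix.of fun a b => y i a * y i b) = vecMulVec (y i).ofLp (y i).ofLp := rfl
  simp only [sum_mulVec, dotProduct_sum, hvec, vecMulVec_mulVec]
  refine Finset.sum_congr rfl fun i _ => ?_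
  have hinner : ⟪y i, v⟫ = (y i).ofLp ⬝ᵥ v.ofLp := by
    simp [EuclideanSpace.inner_eq_star_dotProduct, dotProduct_comm]
  simp [hinner, dotProduct_comm v.ofLp, sq]

theorem Real.log_cosh_le_half_sq (x : ℝ) : Real.log (Real.cosh x) ≤ x ^ 2 / 2 :=
  (Real.log_le_iff_le_exp (Real.cosh_pos x)).2 (Real.cosh_le_exp_half_sq x)

/-- Unimodality of the balanced Gaussian mixture posterior in the subcritical regime:
if `τ² λ_max(Σ yᵢ yᵢᵀ) < nτ + τ₀` then `β = 0` is the unique global maximizer of the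
log-posterior `g`. -/
theorem gmm_posterior_unimodal {d n : ℕ} (y : Fin n → EuclideanSpace ℝ (Fin d))
    (τ τ₀ : ℝ) (hτ : 0 < τ) (hτ₀ : 0 < τ₀)
    (g : EuclideanSpace ℝ (Fin d) → ℝ)
    (hg : ∀ β, g β = -((n * τ + τ₀) / 2) * ‖β‖ ^ 2
      + ∑ i, Real.log (Real.cosh (τ * ⟪y i, β⟫)))
    (hsub : τ ^ 2 * lamMax (∑ i, Matrix.of fun a b => y i a * y i b) < n * τ + τ₀) :
    ∀ β : EuclideanSpace ℝ (Fin d), β ≠ 0 → g β < g 0 := by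
  intro β hβ
  set A : Matrix (Fin d) (Fin d) ℝ := ∑ i, Matrix.of fun a b => y i a * y i b with hA_def
  have hA : A.IsHermitian := by
    ext a b
    simp [hA_def, Matrix.sum_apply, mul_comm]
  have hquad : ∑ i, ⟪y i, β⟫ ^ 2 ≤ lamMax A * ‖β‖ ^ 2 := by
    rw [sum_inner_sq_eq_dotProduct_mulVec, EuclideanSpace.real_norm_sq_eq]
    simpa [dotProduct, sq] using dotProduct_mulVec_le_lamMax hA β.ofLp
  have hlog : ∑ i, Real.log (Real.cosh (τ * ⟪y i, β⟫)) ≤ τ ^ 2 / 2 * ∑ i, ⟪y i, β⟫ ^ 2 := by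
    rw [Finset.mul_sum]
    refine Finset.sum_le_sum fun i _ => (Real.log_cosh_le_half_sq _).trans_eq ?_
    ring
  have hzero : g 0 = 0 := by simp [hg]
  have hnorm : 0 < ‖β‖ ^ 2 := by positivity
  rw [hzero, hg]
  linarith [mul_le_mul_of_nonneg_left hquad (by positivity : 0 ≤ τ ^ 2 / 2),
    mul_lt_mul_of_pos_right hsub hnorm]
end

section
/- Symmetry breaking of the balanced Gaussian mixture posterior in the supercritical regime. Let y₁,…,y_n ∈ ℝ^d, τ > 0, τ₀ > 0, and define g : ℝ^d → ℝ by g(β) := −((nτ + τ₀)/2)·‖β‖² + Σ_{i=1}^n log cosh(τ·⟨y_i, β⟩). If τ²·λ_max(Σ_{i=1}^n y_i y_iᵀ) > nτ + τ₀, then β = 0 is not a local maximum of g, and g attains its global maximum at some point β̂ ≠ 0; by symmetry (g(−β) = g(β)), −β̂ is also a global maximizer, so the posterior has a pair of symmetric modes. -/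
open RealInnerProductSpace

theorem Real.one_add_sq_div_two_le_cosh (x : ℝ) : 1 + x ^ 2 / 2 ≤ Real.cosh x := by
  have habs : |x| / 2 ≤ Real.sinh (|x| / 2) := Real.self_le_sinh_iff.2 (by positivity)
  have h1 : Real.cosh x = 1 + 2 * Real.sinh (|x| / 2) ^ 2 := by
    have h2 := Real.cosh_two_mul (|x| / 2)
    rw [mul_div_cancel₀ _ two_ne_zero, Real.cosh_abs, Real.cosh_sq] at h2
    linarith
  have h3 : (|x| / 2) ^ 2 ≤ Real.sinh (|x| / 2) ^ 2 := by gcongr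
  rw [div_pow, sq_abs] at h3
  linarith

theorem Real.sq_div_two_add_sq_le_log_cosh (x : ℝ) :
    x ^ 2 / (2 + x ^ 2) ≤ Real.log (Real.cosh x) := by
  have h1 := Real.one_add_sq_div_two_le_cosh x
  have h2 := Real.one_sub_inv_le_log_of_pos (Real.cosh_pos x)
  have h3 : (Real.cosh x)⁻¹ ≤ (1 + x ^ 2 / 2)⁻¹ := by gcongr
  have h4 : x ^ 2 / (2 + x ^ 2) = 1 - (1 + x ^ 2 / 2)⁻¹ := by
    have : 2 + x ^ 2 ≠ 0 := by positivity
    have : 1 + x ^ 2 / 2 ≠ 0 := by positivity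
    field_simp
    ring
  linarith

theorem Real.log_cosh_le_abs (x : ℝ) : Real.log (Real.cosh x) ≤ |x| := by
  rw [Real.log_le_iff_le_exp (Real.cosh_pos x), ← Real.cosh_abs, Real.cosh_eq]
  have : Real.exp (-|x|) ≤ Real.exp |x| := Real.exp_le_exp.2 (by linarith [abs_nonneg x])
  linarith

/-- A nonnegative lower bound on `lamMax` of a sum of outer products is witnessed by a vector. -/
theorem exists_lt_sum_inner_sq_of_lt_lamMax {d n : ℕ} (y : Fin n → EuclideanSpace ℝ (Fin d))
    {c : ℝ} (hc : 0 ≤ c)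
    (h : c < lamMax (∑ i, Matrix.of fun a b => y i a * y i b)) :
    ∃ v : EuclideanSpace ℝ (Fin d), c * ‖v‖ ^ 2 < ∑ i, ⟪y i, v⟫ ^ 2 := by
  set A : Matrix (Fin d) (Fin d) ℝ := ∑ i, Matrix.of fun a b => y i a * y i b with hA
  have hne : (spectrum ℝ A).Nonempty := by
    by_contra hemp
    rw [Set.not_nonempty_iff_eq_empty] at hemp
    rw [lamMax, hemp, Real.sSup_empty] at h
    linarith
  obtain ⟨μ, hμ, hcμ⟩ := exists_lt_of_lt_csSup hne h
  rw [← Matrix.spectrum_toLin', ← Module.End.hasEigenvalue_iff_mem_spectrum] at hμ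
  obtain ⟨v, hv⟩ := hμ.exists_hasEigenvector
  have hAv : A.mulVec v = μ • v := by simpa using hv.apply_eq_smul
  refine ⟨WithLp.toLp 2 v, ?_⟩
  have hpos : 0 < ‖WithLp.toLp 2 v‖ ^ 2 := by
    have : WithLp.toLp 2 v ≠ 0 := by simpa using hv.2
    positivity
  have hquad : ∑ i, ⟪y i, WithLp.toLp 2 v⟫ ^ 2 = v ⬝ᵥ A.mulVec v := by
    rw [hA, Matrix.sum_mulVec, dotProduct_sum]
    refine Finset.sum_congr rfl fun i _ => ?_
    simp only [PiLp.inner_apply, dotProduct, Matrix.mulVec, Matrix.of_apply, sq,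
      Finset.mul_sum, Finset.sum_mul]
    refine Finset.sum_congr rfl fun a _ => Finset.sum_congr rfl fun b _ => ?_
    simp
    ring
  have hnorm : v ⬝ᵥ v = ‖WithLp.toLp 2 v‖ ^ 2 := by
    rw [EuclideanSpace.real_norm_sq_eq]
    simp [dotProduct, sq]
  rw [hquad, hAv, dotProduct_smul, hnorm, smul_eq_mul]
  gcongr

/-- Symmetry breaking of the balanced Gaussian mixture posterior in the supercritical
regime: if `τ² λ_max(Σ yᵢ yᵢᵀ) > nτ + τ₀` then `β = 0` is not a local maximum of the
log-posterior `g`, and `g` attains its global maximum at a pair of symmetric points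
`β̂ ≠ 0` and `-β̂`. -/
theorem gmm_posterior_symmetry_breaking {d n : ℕ} (y : Fin n → EuclideanSpace ℝ (Fin d))
    (τ τ₀ : ℝ) (hτ : 0 < τ) (hτ₀ : 0 < τ₀)
    (g : EuclideanSpace ℝ (Fin d) → ℝ)
    (hg : ∀ β, g β = -((n * τ + τ₀) / 2) * ‖β‖ ^ 2
      + ∑ i, Real.log (Real.cosh (τ * ⟪y i, β⟫)))
    (hsup : τ ^ 2 * lamMax (∑ i, Matrix.of fun a b => y i a * y i b) > n * τ + τ₀) :
    ¬ IsLocalMax g 0 ∧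
    ∃ βhat : EuclideanSpace ℝ (Fin d), βhat ≠ 0 ∧
      (∀ β, g β ≤ g βhat) ∧ (∀ β, g β ≤ g (-βhat)) := by
  set c : ℝ := n * τ + τ₀ with hc
  have hc0 : 0 < c := by positivity
  have hg0 : g 0 = 0 := by simp [hg]
  have hlocal : ¬ IsLocalMax g 0 := by
    obtain ⟨v, hv⟩ := exists_lt_sum_inner_sq_of_lt_lamMax y (c := c / τ ^ 2) (by positivity)
      (by rw [div_lt_iff₀' (by positivity)]; exact hsup)
    intro hmax
    let φ : ℝ → ℝ := fun s =>
      -(c / 2) * ‖v‖ ^ 2 + ∑ i, (τ * ⟪y i, v⟫) ^ 2 / (2 + (τ * (s * ⟪y i, v⟫)) ^ 2)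
    have hφ : Continuous φ := by
      refine continuous_const.add (continuous_finsetSum _ fun i _ => ?_)
      exact continuous_const.div (by fun_prop) fun s => by positivity
    have hφ0 : 0 < φ 0 := by
      have h1 : φ 0 = τ ^ 2 / 2 * (∑ i, ⟪y i, v⟫ ^ 2 - c / τ ^ 2 * ‖v‖ ^ 2) := by
        have h2 : ∑ i, (τ * ⟪y i, v⟫) ^ 2 / (2 + (τ * (0 * ⟪y i, v⟫)) ^ 2) =
            τ ^ 2 / 2 * ∑ i, ⟪y i, v⟫ ^ 2 := by
          rw [Finset.mul_sum]
          exact Finset.sum_congr rfl fun i _ => by ring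
        simp only [φ, h2]
        field_simp
        ring
      rw [h1]
      exact mul_pos (by positivity) (sub_pos.2 hv)
    have hφg : ∀ s, s ^ 2 * φ s ≤ g (s • v) := by
      intro s
      rw [hg, norm_smul, mul_pow, Real.norm_eq_abs, sq_abs, mul_add, Finset.mul_sum]
      refine add_le_add (le_of_eq (by ring)) (Finset.sum_le_sum fun i _ => ?_)
      rw [real_inner_smul_right]
      refine le_trans (le_of_eq ?_) (Real.sq_div_two_add_sq_le_log_cosh _)
      ring
    have hline : Filter.Tendsto (fun s : ℝ => s • v) (nhds 0) (nhds 0) := by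
      have : Continuous fun s : ℝ => s • v := by fun_prop
      simpa using this.tendsto 0
    have hev := (hline.eventually hmax).and (hφ.continuousAt.eventually (lt_mem_nhds hφ0))
    obtain ⟨s, ⟨hs, hφs⟩, hs0⟩ :=
      ((hev.filter_mono nhdsWithin_le_nhds).and
        (self_mem_nhdsWithin : {(0 : ℝ)}ᶜ ∈ nhdsWithin 0 {0}ᶜ)).exists
    have hs0' : s ≠ 0 := hs0
    have : 0 < s ^ 2 * φ s := by positivity
    linarith [hφg s]
  have hcont : Continuous g := by
    rw [funext hg]
    refine (by fun_prop : Continuous _).add (continuous_finsetSum _ fun i _ => ?_)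
    exact Continuous.log (Real.continuous_cosh.comp (by fun_prop)) fun β => (Real.cosh_pos _).ne'
  have hbound : ∀ β, g β ≤ ‖β‖ * (τ * ∑ i, ‖y i‖ - c / 2 * ‖β‖) := by
    intro β
    have h1 : ∑ i, Real.log (Real.cosh (τ * ⟪y i, β⟫)) ≤ ∑ i, τ * (‖y i‖ * ‖β‖) := by
      refine Finset.sum_le_sum fun i _ => (Real.log_cosh_le_abs _).trans ?_
      rw [abs_mul, abs_of_pos hτ]
      gcongr
      exact abs_real_inner_le_norm _ _
    rw [← Finset.mul_sum, ← Finset.sum_mul] at h1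
    rw [hg]
    linarith
  obtain ⟨βhat, hβ⟩ := hcont.exists_forall_ge' 0 (by
    filter_upwards [(tendsto_norm_cocompact_atTop (E := EuclideanSpace ℝ (Fin d))).eventually_ge_atTop
      (τ * ∑ i, ‖y i‖ / (c / 2))] with β h
    rw [← Finset.sum_div, ← mul_div_assoc, div_le_iff₀' (by positivity)] at h
    rw [hg0]
    exact (hbound β).trans (mul_nonpos_of_nonneg_of_nonpos (norm_nonneg _) (by linarith)))
  have hneg : g (-βhat) = g βhat := by simp [hg]
  refine ⟨hlocal, βhat, ?_, hβ, fun β => hneg ▸ hβ β⟩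
  rintro rfl
  exact hlocal (Filter.Eventually.of_forall hβ)
end

section
/- Local exponential convergence of CAVI for the Bayesian Gaussian mixture model (Proposition 1, restated in terms of the variational means). Let y₁,…,y_n ∈ ℝ^d, τ > 0, τ₀ > 0, p ∈ (0,1), and define F : ℝ^d → ℝ^d by F(m) := (τ₀ + nτ)⁻¹ · τ · Σ_{i=1}^n tanh((1/2)·log(p/(1−p)) + τ·⟨y_i, m⟩) · y_i. Let m⋆ be a fixed point of F, let ε > 0, and set r_ε := (τ²/(τ₀ + τn)) · sup over x with ‖x − m⋆‖ ≤ ε of λ_max(Σ_{i=1}^n sech²((1/2)·log(p/(1−p)) + τ·⟨y_i, x⟩) · y_i y_iᵀ). If r_ε < 1, then for every m₀ with ‖m₀ − m⋆‖ < ε, the iterates m_{k+1} := F(m_k) satisfy ‖m_k − m⋆‖ ≤ r_ε^k · ‖m₀ − m⋆‖ for all k ≥ 0 (and in particular remain in the ε-ball). -/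
open RealInnerProductSpace

theorem Real.hasDerivAt_tanh (x : ℝ) :
    HasDerivAt Real.tanh ((1 / Real.cosh x) ^ 2) x := by
  have hfun : Real.tanh = fun t => Real.sinh t / Real.cosh t :=
    funext Real.tanh_eq_sinh_div_cosh
  have hcosh : Real.cosh x ≠ 0 := (Real.cosh_pos x).ne'
  rw [hfun]
  refine ((Real.hasDerivAt_sinh x).fun_div (Real.hasDerivAt_cosh x) hcosh).congr_deriv ?_
  rw [div_pow, one_pow, ← Real.cosh_sq_sub_sinh_sq x, sq, sq]

section lamMax

variable {d : ℕ} {A : Matrix (Fin d) (Fin d) ℝ}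

theorem Matrix.IsHermitian.eigenvalues_le_lamMax (hA : A.IsHermitian) (i : Fin d) :
    hA.eigenvalues i ≤ lamMax A := by
  rw [lamMax, hA.spectrum_real_eq_range_eigenvalues]
  exact le_csSup (Set.finite_range _).bddAbove (Set.mem_range_self i)

theorem Matrix.PosSemidef.lamMax_nonneg (hA : A.PosSemidef) : 0 ≤ lamMax A := by
  rw [lamMax, hA.1.spectrum_real_eq_range_eigenvalues]
  refine Real.sSup_nonneg ?_
  rintro _ ⟨i, rfl⟩
  exact hA.eigenvalues_nonneg i

theorem Matrix.PosSemidef.lamMax_le_trace (hA : A.PosSemidef) : lamMax A ≤ A.trace := by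
  have htrace : A.trace = ∑ i, hA.1.eigenvalues i := by
    simpa using hA.1.trace_eq_sum_eigenvalues
  rw [lamMax, hA.1.spectrum_real_eq_range_eigenvalues, htrace]
  refine Real.sSup_le ?_ (Finset.sum_nonneg fun i _ => hA.eigenvalues_nonneg i)
  rintro _ ⟨i, rfl⟩
  exact Finset.single_le_sum (fun j _ => hA.eigenvalues_nonneg j) (Finset.mem_univ i)

theorem Matrix.PosSemidef.norm_toEuclideanLin_le (hA : A.PosSemidef)
    (v : EuclideanSpace ℝ (Fin d)) : ‖A.toEuclideanLin v‖ ≤ lamMax A * ‖v‖ := by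
  let b := hA.1.eigenvectorBasis
  have happly (i : Fin d) : A.toEuclideanLin (b i) = hA.1.eigenvalues i • b i := by
    ext j
    simpa using congrFun (hA.1.mulVec_eigenvectorBasis i) j
  have hinner (i : Fin d) :
      ⟪b i, A.toEuclideanLin v⟫ = hA.1.eigenvalues i * ⟪b i, v⟫ := by
    rw [← Matrix.isSymmetric_toEuclideanLin_iff.mpr hA.1 (b i) v, happly, real_inner_smul_left]
  refine le_of_sq_le_sq ?_ (mul_nonneg hA.lamMax_nonneg (norm_nonneg v))
  rw [mul_pow, ← b.sum_sq_inner_right, ← b.sum_sq_inner_right v, Finset.mul_sum]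
  gcongr with i
  rw [hinner, mul_pow]
  gcongr
  · exact hA.eigenvalues_nonneg i
  · exact hA.1.eigenvalues_le_lamMax i

end lamMax

section outerSum

variable {d n : ℕ} (y : Fin n → EuclideanSpace ℝ (Fin d)) (w : Fin n → ℝ)

/-- The weighted sum of outer products `∑ i, w i • y i (y i)ᵀ`. -/
def outerSum : Matrix (Fin d) (Fin d) ℝ :=
  ∑ i, w i • Matrix.of fun a b => y i a * y i b

theorem outerSum_posSemidef (hw : ∀ i, 0 ≤ w i) : (outerSum y w).PosSemidef :=
  Matrix.posSemidef_sum _ fun i _ =>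
    (Matrix.posSemidef_vecMulVec_self_star (y i).ofLp).smul (hw i)

theorem toEuclideanLin_outerSum (v : EuclideanSpace ℝ (Fin d)) :
    (outerSum y w).toEuclideanLin v = ∑ i, (w i * ⟪y i, v⟫) • y i := by
  ext a
  simp only [outerSum, map_sum, map_smul, LinearMap.sum_apply, LinearMap.smul_apply,
    PiLp.smul_apply, WithLp.ofLp_sum, Finset.sum_apply, smul_eq_mul]
  refine Finset.sum_congr rfl fun i _ => ?_
  simp only [Matrix.toLpLin_apply, Matrix.mulVec, dotProduct, Matrix.of_apply,
    PiLp.inner_apply, RCLike.inner_apply, conj_trivial, Finset.mul_sum, Finset.sum_mul]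
  exact Finset.sum_congr rfl fun b _ => by ring

theorem trace_outerSum : (outerSum y w).trace = ∑ i, w i * ‖y i‖ ^ 2 := by
  simp only [outerSum, Matrix.trace_sum, Matrix.trace_smul, smul_eq_mul]
  refine Finset.sum_congr rfl fun i _ => ?_
  rw [EuclideanSpace.real_norm_sq_eq]
  simp [Matrix.trace, sq]

theorem lamMax_outerSum_le (hw : ∀ i, 0 ≤ w i) (hw₁ : ∀ i, w i ≤ 1) :
    lamMax (outerSum y w) ≤ ∑ i, ‖y i‖ ^ 2 := by
  refine (outerSum_posSemidef y w hw).lamMax_le_trace.trans ?_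
  rw [trace_outerSum]
  exact Finset.sum_le_sum fun i _ => mul_le_of_le_one_left (sq_nonneg _) (hw₁ i)

end outerSum

section tanhMean

variable {d n : ℕ} (y : Fin n → EuclideanSpace ℝ (Fin d)) (h τ : ℝ)

theorem sq_one_div_cosh_le_one (x : ℝ) : (1 / Real.cosh x) ^ 2 ≤ 1 := by
  have h₁ : 1 / Real.cosh x ≤ 1 := (div_le_one (Real.cosh_pos x)).mpr (Real.one_le_cosh x)
  exact pow_le_one₀ (one_div_nonneg.mpr (Real.cosh_pos x).le) h₁

theorem hasDerivAt_sum_tanh_smul_segment (x v : EuclideanSpace ℝ (Fin d)) (t : ℝ) :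
    HasDerivAt (fun s : ℝ => ∑ i, Real.tanh (h + τ * ⟪y i, x + s • v⟫) • y i)
      (τ • (outerSum y fun i =>
        (1 / Real.cosh (h + τ * ⟪y i, x + t • v⟫)) ^ 2).toEuclideanLin v) t := by
  rw [toEuclideanLin_outerSum, Finset.smul_sum]
  refine HasDerivAt.fun_sum fun i _ => ?_
  have hlin : HasDerivAt (fun s : ℝ => h + τ * ⟪y i, x + s • v⟫) (τ * ⟪y i, v⟫) t := by
    simp only [inner_add_right, real_inner_smul_right]
    simpa using
      ((((hasDerivAt_id t).mul_const ⟪y i, v⟫).const_add ⟪y i, x⟫).const_mul τ).const_add h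
  refine (((Real.hasDerivAt_tanh _).comp t hlin).smul_const (y i)).congr_deriv ?_
  rw [smul_smul]
  congr 1
  ring

theorem norm_sum_tanh_smul_sub_le {x z : EuclideanSpace ℝ (Fin d)} {ε L : ℝ} (hτ : 0 ≤ τ)
    (hz : ‖z - x‖ ≤ ε)
    (hL : ∀ u, ‖u - x‖ ≤ ε →
      lamMax (outerSum y fun i => (1 / Real.cosh (h + τ * ⟪y i, u⟫)) ^ 2) ≤ L) :
    ‖∑ i, Real.tanh (h + τ * ⟪y i, z⟫) • y i - ∑ i, Real.tanh (h + τ * ⟪y i, x⟫) • y i‖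
      ≤ τ * L * ‖z - x‖ := by
  have hmvt := norm_image_sub_le_of_norm_deriv_le_segment_01' (C := τ * L * ‖z - x‖)
    (fun t _ => (hasDerivAt_sum_tanh_smul_segment y h τ x (z - x) t).hasDerivWithinAt)
    (fun t ht => ?_)
  · simpa using hmvt
  · rw [norm_smul, Real.norm_of_nonneg hτ, mul_assoc]
    refine mul_le_mul_of_nonneg_left ?_ hτ
    refine ((outerSum_posSemidef y _ fun i => sq_nonneg _).norm_toEuclideanLin_le _).trans ?_
    refine mul_le_mul_of_nonneg_right (hL _ ?_) (norm_nonneg _)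
    rw [add_sub_cancel_left, norm_smul, Real.norm_of_nonneg ht.1]
    exact (mul_le_of_le_one_left (norm_nonneg _) ht.2.le).trans hz

end tanhMean

/-- Local exponential convergence of CAVI for the Bayesian Gaussian mixture model
(Proposition 1, restated in terms of the variational means). -/
theorem gmm_cavi_local_convergence {d n : ℕ} (y : Fin n → EuclideanSpace ℝ (Fin d))
    (τ τ₀ p ε : ℝ) (hτ : 0 < τ) (hτ₀ : 0 < τ₀) (hp : p ∈ Set.Ioo (0 : ℝ) 1) (hε : 0 < ε)
    (F : EuclideanSpace ℝ (Fin d) → EuclideanSpace ℝ (Fin d))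
    (hF : ∀ m, F m = ((τ₀ + n * τ)⁻¹ * τ) •
      ∑ i, Real.tanh ((1 / 2) * Real.log (p / (1 - p)) + τ * ⟪y i, m⟫) • y i)
    (mstar : EuclideanSpace ℝ (Fin d)) (hfix : F mstar = mstar)
    (rε : ℝ)
    (hrε : rε = τ ^ 2 / (τ₀ + τ * n) *
      sSup {t : ℝ | ∃ x : EuclideanSpace ℝ (Fin d), ‖x - mstar‖ ≤ ε ∧
        t = lamMax (∑ i,
          (1 / Real.cosh ((1 / 2) * Real.log (p / (1 - p)) + τ * ⟪y i, x⟫)) ^ 2 •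
            Matrix.of fun a b => y i a * y i b)})
    (hr : rε < 1)
    (m : ℕ → EuclideanSpace ℝ (Fin d)) (hm0 : ‖m 0 - mstar‖ < ε)
    (hrec : ∀ k, m (k + 1) = F (m k)) :
    ∀ k, ‖m k - mstar‖ ≤ rε ^ k * ‖m 0 - mstar‖ ∧ ‖m k - mstar‖ < ε := by
  set h : ℝ := (1 / 2) * Real.log (p / (1 - p))
  set S : Set ℝ := {t : ℝ | ∃ x : EuclideanSpace ℝ (Fin d), ‖x - mstar‖ ≤ ε ∧
    t = lamMax (outerSum y fun i => (1 / Real.cosh (h + τ * ⟪y i, x⟫)) ^ 2)}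
  change rε = τ ^ 2 / (τ₀ + τ * n) * sSup S at hrε
  have hbdd : BddAbove S := by
    refine ⟨∑ i, ‖y i‖ ^ 2, ?_⟩
    rintro _ ⟨x, -, rfl⟩
    exact lamMax_outerSum_le y _ (fun i => sq_nonneg _) fun i => sq_one_div_cosh_le_one _
  have hsup : 0 ≤ sSup S := by
    refine Real.sSup_nonneg ?_
    rintro _ ⟨x, -, rfl⟩
    exact (outerSum_posSemidef y _ fun i => sq_nonneg _).lamMax_nonneg
  have hr₀ : 0 ≤ rε := hrε ▸ by positivity
  have hcontract (x : EuclideanSpace ℝ (Fin d)) (hx : ‖x - mstar‖ ≤ ε) :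
      ‖F x - mstar‖ ≤ rε * ‖x - mstar‖ := by
    have hc : 0 ≤ (τ₀ + n * τ)⁻¹ * τ := by positivity
    calc ‖F x - mstar‖ = ‖F x - F mstar‖ := by rw [hfix]
      _ ≤ (τ₀ + n * τ)⁻¹ * τ * (τ * sSup S * ‖x - mstar‖) := by
        rw [hF, hF, ← smul_sub, norm_smul, Real.norm_of_nonneg hc]
        exact mul_le_mul_of_nonneg_left
          (norm_sum_tanh_smul_sub_le y h τ hτ.le hx fun u hu => le_csSup hbdd ⟨u, hu, rfl⟩) hc
      _ = rε * ‖x - mstar‖ := by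
        rw [hrε, div_eq_mul_inv, mul_comm τ (n : ℝ)]
        ring
  intro k
  induction k with
  | zero => simpa using hm0
  | succ k ih =>
    have hstep := hcontract (m k) ih.2.le
    rw [hrec]
    refine ⟨hstep.trans ?_, hstep.trans_lt ?_⟩
    · rw [pow_succ', mul_assoc]
      exact mul_le_mul_of_nonneg_left ih.1 hr₀
    · exact (mul_le_of_le_one_left (norm_nonneg _) hr.le).trans_lt ih.2
end
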